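/- Let h : ℕ → ℕ be inflationary (h(m) ≥ m for all m) and let 𝒪 be a collection of set-functions each of which is h-continuous on the whole space. Let f : ℕ^k → ℕ be a function such that for every q ≥ 0 the set {f(n⃗) : n⃗ ∈ ℕ^k, h^{(q)}(f(n⃗)) < min(n⃗)} is infinite, where h^{(q)} is the q-fold iterate of h. Then the numerical function f is not (𝒪 ∪ 𝒫)-definable. -/

import Mathlib

noncomputable section
open Classical

/-- `s ⊕ t`: lifted addition on sets of naturals. -/
def setPlus (s t : Set ℕ) : Set ℕ := {u | ∃ m ∈ s, ∃ n ∈ t, u = m + n}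

/-- `s ⊗ t`: lifted multiplication on sets of naturals. -/
def setTimes (s t : Set ℕ) : Set ℕ := {u | ∃ m ∈ s, ∃ n ∈ t, u = m * n}

/-- Sets of naturals definable by (variable-free) arithmetic circuits:
the smallest collection containing `∅`, `ℕ`, all singletons, closed under
union, intersection, complement, `⊕` and `⊗`. -/
inductive ArithDefinable : Set ℕ → Prop
  | empty : ArithDefinable ∅
  | univ : ArithDefinable Set.univ
  | single (k : ℕ) : ArithDefinable {k}
  | union : ∀ {s t : Set ℕ}, ArithDefinable s → ArithDefinable t → ArithDefinable (s ∪ t)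
  | inter : ∀ {s t : Set ℕ}, ArithDefinable s → ArithDefinable t → ArithDefinable (s ∩ t)
  | compl : ∀ {s : Set ℕ}, ArithDefinable s → ArithDefinable sᶜ
  | plus : ∀ {s t : Set ℕ}, ArithDefinable s → ArithDefinable t → ArithDefinable (setPlus s t)
  | times : ∀ {s t : Set ℕ}, ArithDefinable s → ArithDefinable t → ArithDefinable (setTimes s t)

/-- A set-function of arity `k`. -/
abbrev SetFun (k : ℕ) := (Fin k → Set ℕ) → Set ℕ

/-- The `𝒪`-definable functions `ℙ^n → ℙ`, for a collection `O` of set-functions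
(given per arity): smallest class containing projections and the constants
`∅`, `ℕ`, `{k}`, closed under pointwise union, intersection, complement, and
composition with functions in `O`. -/
inductive ODef (O : ∀ k, Set (SetFun k)) (n : ℕ) : SetFun n → Prop
  | proj (i : Fin n) : ODef O n (fun s => s i)
  | empty : ODef O n (fun _ => ∅)
  | univ : ODef O n (fun _ => Set.univ)
  | single (k : ℕ) : ODef O n (fun _ => {k})
  | union : ∀ {F G : SetFun n}, ODef O n F → ODef O n G → ODef O n (fun s => F s ∪ G s)
  | inter : ∀ {F G : SetFun n}, ODef O n F → ODef O n G → ODef O n (fun s => F s ∩ G s)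
  | compl : ∀ {F : SetFun n}, ODef O n F → ODef O n (fun s => (F s)ᶜ)
  | comp : ∀ {k : ℕ} {g : SetFun k} {F : Fin k → SetFun n},
      g ∈ O k → (∀ i, ODef O n (F i)) → ODef O n (fun s => g (fun i => F i s))

/-- `s_{|m} = s ∩ {0,…,m}`. -/
def restrict (s : Set ℕ) (m : ℕ) : Set ℕ := s ∩ {k | k ≤ m}

/-- `F` is `h`-continuous on `D`. -/
def HCont (h : ℕ → ℕ) {n : ℕ} (F : SetFun n) (D : Set (Fin n → Set ℕ)) : Prop :=
  ∀ m : ℕ, ∀ s ∈ D, ∀ t ∈ D,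
    (∀ i, restrict (s i) (h m) = restrict (t i) (h m)) →
    restrict (F s) m = restrict (F t) m

/-- `F` is uniformly continuous on `D`. -/
def UnifCont {n : ℕ} (F : SetFun n) (D : Set (Fin n → Set ℕ)) : Prop :=
  ∃ h : ℕ → ℕ, HCont h F D

/-- `𝒰`: set-functions (of arity `k`) uniformly continuous on the whole space. -/
def Ucal (k : ℕ) : Set (SetFun k) := {g | UnifCont g Set.univ}

/-- `𝒫`: predicates, i.e. set-functions with values among `∅` and `{0}`. -/
def Pcal (k : ℕ) : Set (SetFun k) := {g | ∀ s, g s = ∅ ∨ g s = {0}}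

/-- `𝒰 ∪ 𝒫`. -/
def UPcal (k : ℕ) : Set (SetFun k) := Ucal k ∪ Pcal k

/-- `Max(x)`. -/
def MaxFun (x : Set ℕ) : Set ℕ :=
  if x = ∅ then ∅ else if x.Infinite then Set.univ else {sSup x}

/-- `Card(x)`. -/
def CardFun (x : Set ℕ) : Set ℕ := if x.Finite then {x.ncard} else Set.univ

/-- `↓(x)`. -/
def DownFun (x : Set ℕ) : Set ℕ := {m | ∃ n ∈ x, m ≤ n}

/-- `Sum(x)`. -/
def SumFun (x : Set ℕ) : Set ℕ := if x.Finite then {∑ᶠ n ∈ x, n} else Set.univ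

/-- `Prod(x)`. -/
def ProdFun (x : Set ℕ) : Set ℕ := if x.Finite then {∏ᶠ n ∈ x, n} else Set.univ

/-- `Shove(x) = {n - min x : n ∈ x}` (empty for `x = ∅`). -/
def ShoveFun (x : Set ℕ) : Set ℕ := (fun n => n - sInf x) '' x

/-- `ε(x)`: the test for emptiness. -/
def epsFun (x : Set ℕ) : Set ℕ := if x = ∅ then {0} else ∅

/-- `Fin(x)`: the test for finiteness. -/
def FinFun (x : Set ℕ) : Set ℕ := if x.Finite then {0} else ∅

/-- `⊕` as a set-function of arity 2. -/
def plusFun : SetFun 2 := fun s => setPlus (s 0) (s 1)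

/-- `⊗` as a set-function of arity 2. -/
def timesFun : SetFun 2 := fun s => setTimes (s 0) (s 1)

/-- `↓` as a set-function of arity 1. -/
def downFun1 : SetFun 1 := fun s => DownFun (s 0)

/-- `ε` as a set-function of arity 1. -/
def epsFun1 : SetFun 1 := fun s => epsFun (s 0)

/-- The collection `{⊕, ⊗}`. -/
def arithO : ∀ k, Set (SetFun k)
  | 2 => {plusFun, timesFun}
  | _ => ∅

/-- The collection `{⊕}`. -/
def addO : ∀ k, Set (SetFun k)
  | 2 => {plusFun}
  | _ => ∅

/-- The collection `{⊕, ↓} ∪ 𝒫`. -/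
def addDownO : ∀ k, Set (SetFun k)
  | 1 => insert downFun1 (Pcal 1)
  | 2 => insert plusFun (Pcal 2)
  | k => Pcal k

/-- The collection `{⊕, ⊗, ↓} ∪ 𝒫`. -/
def arithDownO : ∀ k, Set (SetFun k)
  | 1 => insert downFun1 (Pcal 1)
  | 2 => {plusFun, timesFun} ∪ Pcal 2
  | k => Pcal k

/-- The collection `𝒰 ∪ {ε}`. -/
def UEps : ∀ k, Set (SetFun k)
  | 1 => insert epsFun1 (Ucal 1)
  | k => Ucal k

/-- The collection `{⊕, ⊗} ∪ 𝒫`. -/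
def arithPO (k : ℕ) : Set (SetFun k) := arithO k ∪ Pcal k

/-- A numerical function `ℕ → ℕ` is `O`-definable if some `O`-definable
set-function maps `{m}` to `{f m}` for every `m`. -/
def NumDef1 (O : ∀ k, Set (SetFun k)) (f : ℕ → ℕ) : Prop :=
  ∃ F : SetFun 1, ODef O 1 F ∧ ∀ m : ℕ, F (fun _ => {m}) = {f m}

/-- A numerical function `ℕ^k → ℕ` is `O`-definable if some `O`-definable
set-function maps tuples of singletons to the corresponding singleton value. -/
def NumDef (O : ∀ k, Set (SetFun k)) (k : ℕ) (f : (Fin k → ℕ) → ℕ) : Prop :=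
  ∃ F : SetFun k, ODef O k F ∧ ∀ m : Fin k → ℕ, F (fun i => ({m i} : Set ℕ)) = {f m}

/-- `f` is regressive: `{f n : f n < n}` is infinite. -/
def Regressive (f : ℕ → ℕ) : Prop := {y | ∃ n, f n = y ∧ y < n}.Infinite

/-- `f` is semi-regressive: for every `ℓ` there is `n` with `n + ℓ ≤ f n ≤ 2n - 2`. -/
def SemiRegressive (f : ℕ → ℕ) : Prop :=
  ∀ ℓ : ℕ, ∃ n : ℕ, n + ℓ ≤ f n ∧ (f n : ℤ) ≤ 2 * (n : ℤ) - 2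

theorem restrict_eq_restrict_iff {s t : Set ℕ} {m : ℕ} :
    restrict s m = restrict t m ↔ ∀ j ≤ m, (j ∈ s ↔ j ∈ t) := by
  simp only [restrict, Set.ext_iff, Set.mem_inter_iff, Set.mem_ofPred_eq]
  exact forall_congr' fun j => by tauto

/-- `h`-continuity on a fixed domain is inherited by pointwise larger moduli. -/
theorem HCont.mono_modulus {h h' : ℕ → ℕ} {n : ℕ} {F : SetFun n} {D : Set (Fin n → Set ℕ)}
    (hF : HCont h F D) (hle : ∀ m, h m ≤ h' m) : HCont h' F D := fun m s hs t ht hst =>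
  hF m s hs t ht fun i => restrict_eq_restrict_iff.2 fun j hj =>
    restrict_eq_restrict_iff.1 (hst i) j (hj.trans (hle m))

theorem HCont.mono_domain {h : ℕ → ℕ} {n : ℕ} {F : SetFun n} {D D' : Set (Fin n → Set ℕ)}
    (hF : HCont h F D) (hD : D' ⊆ D) : HCont h F D' := fun m s hs t ht =>
  hF m s (hD hs) t (hD ht)

theorem hCont_const (h : ℕ → ℕ) {n : ℕ} (a : Set ℕ) (D : Set (Fin n → Set ℕ)) :
    HCont h (fun _ => a) D := fun _ _ _ _ _ _ => rfl

theorem iterate_le_iterate_of_inflationary {h : ℕ → ℕ} (hh : ∀ m, m ≤ h m) {p q : ℕ}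
    (hpq : p ≤ q) (m : ℕ) : h^[p] m ≤ h^[q] m :=
  Function.monotone_iterate_of_id_le (f := h) hh hpq m

/-- The domain splits into finitely many pieces on each of which `F` is continuous with
modulus a fixed iterate of `h`. -/
def PiecewiseHCont (h : ℕ → ℕ) {n : ℕ} (F : SetFun n) : Prop :=
  ∃ (ι : Type) (_ : Finite ι) (c : (Fin n → Set ℕ) → ι) (q : ℕ), ∀ a, HCont h^[q] F (c ⁻¹' {a})

theorem HCont.piecewise {h : ℕ → ℕ} {n : ℕ} {F : SetFun n} {q : ℕ}
    (hF : HCont h^[q] F Set.univ) : PiecewiseHCont h F :=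
  ⟨Unit, inferInstance, fun _ => (), q, fun _ => hF.mono_domain (Set.subset_univ _)⟩

/-- Finitely many piecewise continuous functions have a common partition and modulus. -/
theorem PiecewiseHCont.common {h : ℕ → ℕ} (hh : ∀ m, m ≤ h m) {n k : ℕ} {F : Fin k → SetFun n}
    (hF : ∀ i, PiecewiseHCont h (F i)) :
    ∃ (ι : Type) (_ : Finite ι) (c : (Fin n → Set ℕ) → ι) (q : ℕ),
      ∀ i a, HCont h^[q] (F i) (c ⁻¹' {a}) := by
  choose ι hι c q hc using hF
  refine ⟨∀ i, ι i, inferInstance, fun s i => c i s, Finset.univ.sup q, fun i a => ?_⟩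
  have hsub : (fun s i => c i s) ⁻¹' {a} ⊆ c i ⁻¹' {a i} := by
    rintro s rfl
    rfl
  refine ((hc i (a i)).mono_domain hsub).mono_modulus fun m => ?_
  exact iterate_le_iterate_of_inflationary hh (Finset.le_sup (Finset.mem_univ i)) m

theorem PiecewiseHCont.comp {h : ℕ → ℕ} (hh : ∀ m, m ≤ h m) {n k : ℕ} {g : SetFun k}
    (hg : HCont h g Set.univ) {F : Fin k → SetFun n} (hF : ∀ i, PiecewiseHCont h (F i)) :
    PiecewiseHCont h (fun s => g (fun i => F i s)) := by
  obtain ⟨ι, hι, c, q, hc⟩ := PiecewiseHCont.common hh hF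
  exact ⟨ι, hι, c, q + 1, fun a m s hs t ht hst =>
    hg m _ trivial _ trivial fun i => hc i a (h m) s hs t ht hst⟩

theorem piecewiseHCont_of_mem_Pcal (h : ℕ → ℕ) {n k : ℕ} {g : SetFun k} (hg : g ∈ Pcal k)
    (F : Fin k → SetFun n) : PiecewiseHCont h (fun s => g (fun i => F i s)) := by
  refine ⟨Prop, inferInstance, fun s => g (fun i => F i s) = ∅, 0, fun a m s hs t ht _ => ?_⟩
  have hst : (g (fun i => F i s) = ∅) = (g (fun i => F i t) = ∅) := hs.trans ht.symm
  rcases hg (fun i => F i s) with h₁ | h₁ <;> rcases hg (fun i => F i t) with h₂ | h₂ <;>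
    simp_all

theorem hCont_union {h : ℕ → ℕ} (hh : ∀ m, m ≤ h m) :
    HCont h (fun s : Fin 2 → Set ℕ => s 0 ∪ s 1) Set.univ := by
  intro m s _ t _ hst
  simp only [restrict_eq_restrict_iff] at hst ⊢
  exact fun j hj => or_congr (hst 0 j (hj.trans (hh m))) (hst 1 j (hj.trans (hh m)))

theorem hCont_inter {h : ℕ → ℕ} (hh : ∀ m, m ≤ h m) :
    HCont h (fun s : Fin 2 → Set ℕ => s 0 ∩ s 1) Set.univ := by
  intro m s _ t _ hst
  simp only [restrict_eq_restrict_iff] at hst ⊢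
  exact fun j hj => and_congr (hst 0 j (hj.trans (hh m))) (hst 1 j (hj.trans (hh m)))

theorem hCont_compl {h : ℕ → ℕ} (hh : ∀ m, m ≤ h m) :
    HCont h (fun s : Fin 1 → Set ℕ => (s 0)ᶜ) Set.univ := by
  intro m s _ t _ hst
  simp only [restrict_eq_restrict_iff] at hst ⊢
  exact fun j hj => not_congr (hst 0 j (hj.trans (hh m)))

theorem ODef.piecewiseHCont {h : ℕ → ℕ} (hh : ∀ m, m ≤ h m) {O : ∀ k, Set (SetFun k)}
    (hO : ∀ k, ∀ g ∈ O k, HCont h g Set.univ) {n : ℕ} {F : SetFun n}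
    (hF : ODef (fun j => O j ∪ Pcal j) n F) : PiecewiseHCont h F := by
  induction hF with
  | proj i => exact HCont.piecewise (q := 0) fun m s _ t _ hst => hst i
  | empty => exact HCont.piecewise (q := 0) (hCont_const _ _ _)
  | univ => exact HCont.piecewise (q := 0) (hCont_const _ _ _)
  | single k => exact HCont.piecewise (q := 0) (hCont_const _ _ _)
  | @union F G _ _ hF hG =>
    exact PiecewiseHCont.comp hh (hCont_union hh) (F := ![F, G]) (Fin.forall_fin_two.2 ⟨hF, hG⟩)
  | @inter F G _ _ hF hG =>
    exact PiecewiseHCont.comp hh (hCont_inter hh) (F := ![F, G]) (Fin.forall_fin_two.2 ⟨hF, hG⟩)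
  | @compl F _ hF =>
    exact PiecewiseHCont.comp hh (hCont_compl hh) (F := fun _ => F) fun _ => hF
  | comp hg _ hF =>
    rcases hg with hg | hg
    · exact PiecewiseHCont.comp hh (hO _ _ hg) hF
    · exact piecewiseHCont_of_mem_Pcal h hg _

theorem regressive_numerical_not_OP_definable (h : ℕ → ℕ) (hh : ∀ m, m ≤ h m)
    (O : ∀ k, Set (SetFun k)) (hO : ∀ k, ∀ g ∈ O k, HCont h g Set.univ)
    (k : ℕ) (f : (Fin k → ℕ) → ℕ)
    (hf : ∀ q : ℕ, {y : ℕ | ∃ v : Fin k → ℕ, f v = y ∧ ∀ i, h^[q] (f v) < v i}.Infinite) :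
    ¬ NumDef (fun j => O j ∪ Pcal j) k f := by
  rintro ⟨F, hF, hFf⟩
  obtain ⟨ι, hι, c, q, hc⟩ := hF.piecewiseHCont hh hO
  let Y : ι → Set ℕ := fun a => {y | ∃ v : Fin k → ℕ, f v = y ∧ (∀ i, h^[q] (f v) < v i) ∧
    c (fun i => {v i}) = a}
  obtain ⟨a, ha⟩ : ∃ a, (Y a).Infinite := by
    by_contra! hY
    refine hf q ((Set.finite_iUnion hY).subset ?_)
    rintro y ⟨v, hv, hlt⟩
    exact Set.mem_iUnion.2 ⟨_, v, hv, hlt, rfl⟩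
  obtain ⟨_, v, rfl, hv, hva⟩ := ha.nonempty
  obtain ⟨_, ⟨w, rfl, hw, hwa⟩, hvw⟩ := ha.exists_gt (h^[q] (f v))
  have hq : ∀ m, m ≤ h^[q] m := iterate_le_iterate_of_inflationary hh (Nat.zero_le q)
  have key := hc a (f v) _ hva _ hwa fun i => restrict_eq_restrict_iff.2 fun j hj => by
    have h₁ := hv i
    have h₂ := hw i
    have h₃ := hq (f w)
    simp only [Set.mem_singleton_iff]
    omega
  rw [hFf, hFf, restrict_eq_restrict_iff] at key
  have heq : f v = f w := (key (f v) le_rfl).1 rfl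
  have := hq (f v)
  omega

end
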